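/- For every optimal set β of two-means for the discrete measure ν, the set {19/195, 35/39} ∪ β (that is, {S₁(19/39), S₂(19/39)} ∪ β) is an optimal set of four-means for the condensation measure P, and the fourth quantization error of P is V_4(P) = 185729/58292325. -/

import Mathlib

open MeasureTheory Metric Set Filter

/-- The distortion error of a set `α` of quantizer points for `μ`, of order 2:
`∫ min_{a ∈ α} (x - a)^2 dμ(x)`. -/
noncomputable def distortion (μ : MeasureTheory.Measure ℝ) (α : Set ℝ) : ℝ :=
  ∫ x, (Metric.infDist x α) ^ 2 ∂μ

/-- The `n`th quantization error of order 2 for `μ`. -/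
noncomputable def quantErr (μ : MeasureTheory.Measure ℝ) (n : ℕ) : ℝ :=
  sInf {e : ℝ | ∃ α : Set ℝ, α.Finite ∧ α.Nonempty ∧ α.ncard ≤ n ∧ e = distortion μ α}

/-- `α` is an optimal set of `n`-means for `μ`. -/
def IsOptimalSet (μ : MeasureTheory.Measure ℝ) (n : ℕ) (α : Set ℝ) : Prop :=
  α.Finite ∧ α.Nonempty ∧ α.ncard ≤ n ∧ distortion μ α = quantErr μ n

/-- The similarity `S₁(x) = x/5`. -/
noncomputable def S1 : ℝ → ℝ := fun x => x / 5

/-- The similarity `S₂(x) = x/5 + 4/5`. -/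
noncomputable def S2 : ℝ → ℝ := fun x => x / 5 + 4 / 5

/-- `P` is the condensation measure associated with `(S₁, S₂; 1/3, 1/3, 1/3; ν)`:
`P = (1/3) P∘S₁⁻¹ + (1/3) P∘S₂⁻¹ + (1/3) ν`. -/
def IsCondensation (P ν : MeasureTheory.Measure ℝ) : Prop :=
  MeasureTheory.IsProbabilityMeasure P ∧
    P = (1 / 3 : ENNReal) • P.map S1 + (1 / 3 : ENNReal) • P.map S2 + (1 / 3 : ENNReal) • ν

/-- The point `a_{j+1} = 3/5 - 1/(5 · 2^j)` (so `aseq 0 = a₁ = 2/5`). -/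
noncomputable def aseq (j : ℕ) : ℝ := 3 / 5 - 1 / (5 * 2 ^ j)

/-- The infinite discrete distribution `ν = ∑_{j ≥ 1} 2^{-j} δ_{a_j}`. -/
noncomputable def nuDisc : MeasureTheory.Measure ℝ :=
  MeasureTheory.Measure.sum
    (fun j : ℕ => ((1 / 2 : ENNReal) ^ (j + 1)) • MeasureTheory.Measure.dirac (aseq j))

theorem Continuous.integrable_of_ae_mem_Icc {μ : Measure ℝ} [IsFiniteMeasure μ] {a b : ℝ}
    (h : ∀ᵐ x ∂μ, x ∈ Icc a b) {f : ℝ → ℝ} (hf : Continuous f) : Integrable f μ := by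
  have := hf.continuousOn.integrableOn_compact (μ := μ) (isCompact_Icc (a := a) (b := b))
  rwa [IntegrableOn, Measure.restrict_eq_self_of_ae_mem h] at this

theorem integral_le_integral_of_Icc {μ : Measure ℝ} [IsFiniteMeasure μ] {a b : ℝ}
    (h : ∀ᵐ x ∂μ, x ∈ Icc a b) {f g : ℝ → ℝ} (hf : Continuous f) (hg : Continuous g)
    (hfg : ∀ x ∈ Icc a b, f x ≤ g x) : ∫ x, f x ∂μ ≤ ∫ x, g x ∂μ :=
  integral_mono_ae (hf.integrable_of_ae_mem_Icc h) (hg.integrable_of_ae_mem_Icc h)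
    (h.mono fun x hx => hfg x hx)

theorem integral_affine_sq {μ : Measure ℝ} [IsProbabilityMeasure μ] {c d : ℝ}
    (h : ∀ᵐ x ∂μ, x ∈ Icc c d) (a b : ℝ) :
    ∫ x, (a * x + b) ^ 2 ∂μ = a ^ 2 * ∫ x, x ^ 2 ∂μ + 2 * a * b * ∫ x, x ∂μ + b ^ 2 := by
  have e : ∀ x : ℝ, (a * x + b) ^ 2 = (a ^ 2 * x ^ 2 + 2 * a * b * x) + b ^ 2 := fun x => by ring
  simp_rw [e]
  have i1 : Integrable (fun x : ℝ => a ^ 2 * x ^ 2) μ :=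
    Continuous.integrable_of_ae_mem_Icc h (by fun_prop)
  have i2 : Integrable (fun x : ℝ => 2 * a * b * x) μ :=
    Continuous.integrable_of_ae_mem_Icc h (by fun_prop)
  have hadd : Integrable (fun x : ℝ => a ^ 2 * x ^ 2 + 2 * a * b * x) μ := i1.add i2
  rw [integral_add hadd (integrable_const _), integral_add i1 i2,
    integral_const_mul, integral_const_mul]
  simp

theorem integral_affine {μ : Measure ℝ} [IsProbabilityMeasure μ] {c d : ℝ}
    (h : ∀ᵐ x ∂μ, x ∈ Icc c d) (a b : ℝ) :
    ∫ x, (a * x + b) ∂μ = a * ∫ x, x ∂μ + b := by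
  have i2 : Integrable (fun x : ℝ => a * x) μ :=
    Continuous.integrable_of_ae_mem_Icc h (by fun_prop)
  rw [integral_add i2 (integrable_const _), integral_const_mul]
  simp

instance isProbabilityMeasure_nuDisc : IsProbabilityMeasure nuDisc := by
  constructor
  rw [nuDisc, Measure.sum_apply _ MeasurableSet.univ]
  simp only [Measure.smul_apply, measure_univ, smul_eq_mul, mul_one]
  rw [ENNReal.tsum_geometric_add_one]
  simp only [one_div, ENNReal.one_sub_inv_two, inv_inv]
  exact ENNReal.inv_mul_cancel (by simp) (by simp)

theorem ae_nuDisc_mem : ∀ᵐ x ∂nuDisc, x ∈ Icc (2 / 5 : ℝ) (3 / 5) := by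
  rw [nuDisc, Measure.ae_sum_iff]
  intro j
  refine Measure.ae_smul_measure ?_ _
  refine (ae_dirac_iff (p := fun x => x ∈ Icc (2 / 5 : ℝ) (3 / 5)) measurableSet_Icc).2 ?_
  have h1 : (1 : ℝ) ≤ 2 ^ j := one_le_pow₀ (by norm_num)
  have h2 : 1 / (5 * 2 ^ j : ℝ) ≤ 1 / 5 := by
    apply one_div_le_one_div_of_le <;> linarith
  have h3 : 0 ≤ 1 / (5 * 2 ^ j : ℝ) := by positivity
  constructor <;> simp only [aseq] <;> linarith

theorem aseq_succ (j : ℕ) : aseq (j + 1) = aseq j / 2 + 3 / 10 := by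
  simp only [aseq, pow_succ]
  field_simp
  ring

theorem nuDisc_eq : nuDisc = (1 / 2 : ENNReal) • Measure.dirac (2 / 5 : ℝ) +
    (1 / 2 : ENNReal) • nuDisc.map (fun x => x / 2 + 3 / 10) := by
  have hT : Measurable (fun x : ℝ => x / 2 + 3 / 10) := by fun_prop
  have h0 : aseq 0 = 2 / 5 := by norm_num [aseq]
  ext s hs
  rw [Measure.add_apply, Measure.smul_apply, Measure.smul_apply, Measure.map_apply hT hs]
  simp only [nuDisc]
  rw [Measure.sum_apply _ hs, Measure.sum_apply _ (hT hs),
    tsum_eq_zero_add' ENNReal.summable, ← h0]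
  simp only [Measure.smul_apply, smul_eq_mul, ← ENNReal.tsum_mul_left, zero_add, pow_one]
  congr 1
  refine tsum_congr fun j => ?_
  rw [aseq_succ, Measure.dirac_apply' _ hs, Measure.dirac_apply' _ (hT hs), pow_succ' _ (j + 1),
    mul_assoc]
  rfl

theorem integral_nuDisc {f : ℝ → ℝ} (hf : Continuous f) :
    ∫ x, f x ∂nuDisc = 1 / 2 * f (2 / 5) + 1 / 2 * ∫ x, f (x / 2 + 3 / 10) ∂nuDisc := by
  have hT : Measurable (fun x : ℝ => x / 2 + 3 / 10) := by fun_prop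
  have hi : Integrable f nuDisc := hf.integrable_of_ae_mem_Icc ae_nuDisc_mem
  have hi' := hi
  rw [nuDisc_eq, integrable_add_measure] at hi'
  conv_lhs => rw [nuDisc_eq]
  rw [integral_add_measure hi'.1 hi'.2, integral_smul_measure, integral_smul_measure,
    integral_map hT.aemeasurable hf.aestronglyMeasurable, integral_dirac]
  simp

theorem integral_id_nuDisc : ∫ x, x ∂nuDisc = 7 / 15 := by
  have h := integral_nuDisc continuous_id
  simp only [id] at h
  have e : ∀ x : ℝ, x / 2 + 3 / 10 = 1 / 2 * x + 3 / 10 := fun x => by ring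
  simp_rw [e] at h
  rw [integral_affine ae_nuDisc_mem] at h
  linarith

theorem integral_sq_nuDisc : ∫ x, x ^ 2 ∂nuDisc = 39 / 175 := by
  have h := integral_nuDisc (continuous_pow 2)
  have e : ∀ x : ℝ, x / 2 + 3 / 10 = 1 / 2 * x + 3 / 10 := fun x => by ring
  simp_rw [e] at h
  rw [integral_affine_sq ae_nuDisc_mem, integral_id_nuDisc] at h
  linarith

theorem integral_affine_sq_nuDisc (a b : ℝ) :
    ∫ x, (a * x + b) ^ 2 ∂nuDisc = a ^ 2 * (39 / 175) + 2 * a * b * (7 / 15) + b ^ 2 := by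
  rw [integral_affine_sq ae_nuDisc_mem, integral_id_nuDisc, integral_sq_nuDisc]

theorem IsCondensation.ae_mem {P : Measure ℝ} (hP : IsCondensation P nuDisc) :
    ∀ᵐ x ∂P, x ∈ Icc (0 : ℝ) 1 := by
  have := hP.1
  have h1 : Measurable S1 := by unfold S1; fun_prop
  have h2 : Measurable S2 := by unfold S2; fun_prop
  have hs : MeasurableSet (Icc (0 : ℝ) 1)ᶜ := measurableSet_Icc.compl
  rw [ae_iff]
  change P (Icc (0 : ℝ) 1)ᶜ = 0
  have hle : ∀ S : ℝ → ℝ, MapsTo S (Icc 0 1) (Icc 0 1) →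
      P (S ⁻¹' (Icc (0 : ℝ) 1)ᶜ) ≤ P (Icc (0 : ℝ) 1)ᶜ := fun S hS =>
    measure_mono fun x hx hx' => hx (hS hx')
  have hS1 := hle S1 fun x hx => by
    simp only [S1, mem_Icc] at hx ⊢
    constructor <;> linarith
  have hS2 := hle S2 fun x hx => by
    simp only [S2, mem_Icc] at hx ⊢
    constructor <;> linarith
  have hnu : nuDisc (Icc (0 : ℝ) 1)ᶜ = 0 := by
    have : ∀ᵐ x ∂nuDisc, x ∈ Icc (0 : ℝ) 1 := by
      filter_upwards [ae_nuDisc_mem] with x hx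
      constructor <;> linarith [hx.1, hx.2]
    exact this
  have heq : P (Icc (0 : ℝ) 1)ᶜ = 1 / 3 * P (S1 ⁻¹' (Icc (0 : ℝ) 1)ᶜ) +
      1 / 3 * P (S2 ⁻¹' (Icc (0 : ℝ) 1)ᶜ) := by
    conv_lhs => rw [hP.2]
    simp only [Measure.add_apply, Measure.smul_apply, Measure.map_apply h1 hs,
      Measure.map_apply h2 hs, hnu, smul_eq_mul, mul_zero, add_zero]
  have hr := congrArg ENNReal.toReal heq
  rw [ENNReal.toReal_add (by finiteness) (by finiteness), ENNReal.toReal_mul,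
    ENNReal.toReal_mul] at hr
  have r1 := ENNReal.toReal_mono (by finiteness) hS1
  have r2 := ENNReal.toReal_mono (by finiteness) hS2
  simp only [one_div, ENNReal.toReal_inv, ENNReal.toReal_ofNat] at hr
  have h0 : 0 ≤ (P (Icc (0 : ℝ) 1)ᶜ).toReal := ENNReal.toReal_nonneg
  have : (P (Icc (0 : ℝ) 1)ᶜ).toReal = 0 := by linarith
  exact (ENNReal.toReal_eq_zero_iff _).1 this |>.resolve_right (by finiteness)

theorem IsCondensation.integral_eq {P : Measure ℝ} (hP : IsCondensation P nuDisc) {f : ℝ → ℝ}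
    (hf : Continuous f) : ∫ x, f x ∂P =
      1 / 3 * ∫ x, f (x / 5) ∂P + 1 / 3 * ∫ x, f (x / 5 + 4 / 5) ∂P + 1 / 3 * ∫ x, f x ∂nuDisc := by
  have := hP.1
  have h1 : Measurable S1 := by unfold S1; fun_prop
  have h2 : Measurable S2 := by unfold S2; fun_prop
  have hi : Integrable f P := hf.integrable_of_ae_mem_Icc hP.ae_mem
  rw [hP.2, integrable_add_measure, integrable_add_measure] at hi
  conv_lhs => rw [hP.2]
  rw [integral_add_measure (hi.1.1.add_measure hi.1.2) hi.2, integral_add_measure hi.1.1 hi.1.2,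
    integral_smul_measure, integral_smul_measure, integral_smul_measure,
    integral_map h1.aemeasurable hf.aestronglyMeasurable,
    integral_map h2.aemeasurable hf.aestronglyMeasurable]
  simp [S1, S2]

theorem IsCondensation.integral_id {P : Measure ℝ} (hP : IsCondensation P nuDisc) :
    ∫ x, x ∂P = 19 / 39 := by
  have := hP.1
  have h := hP.integral_eq continuous_id
  simp only [id] at h
  have e1 : ∀ x : ℝ, x / 5 = 5⁻¹ * x + 0 := fun x => by ring
  have e2 : ∀ x : ℝ, x / 5 + 4 / 5 = 1 / 5 * x + 4 / 5 := fun x => by ring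
  simp_rw [e2] at h
  simp_rw [e1] at h
  rw [integral_affine hP.ae_mem, integral_affine hP.ae_mem, integral_id_nuDisc] at h
  linarith

theorem IsCondensation.integral_sq {P : Measure ℝ} (hP : IsCondensation P nuDisc) :
    ∫ x, x ^ 2 ∂P = 6953 / 19929 := by
  have := hP.1
  have h := hP.integral_eq (continuous_pow 2)
  have e1 : ∀ x : ℝ, x / 5 = 5⁻¹ * x + 0 := fun x => by ring
  have e2 : ∀ x : ℝ, x / 5 + 4 / 5 = 1 / 5 * x + 4 / 5 := fun x => by ring
  simp_rw [e2] at h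
  simp_rw [e1] at h
  rw [integral_affine_sq hP.ae_mem, integral_affine_sq hP.ae_mem, integral_sq_nuDisc,
    hP.integral_id] at h
  linarith

theorem IsCondensation.integral_affine_sq {P : Measure ℝ} (hP : IsCondensation P nuDisc)
    (a b : ℝ) :
    ∫ x, (a * x + b) ^ 2 ∂P = a ^ 2 * (6953 / 19929) + 2 * a * b * (19 / 39) + b ^ 2 := by
  have := hP.1
  rw [_root_.integral_affine_sq hP.ae_mem, hP.integral_id, hP.integral_sq]

theorem sq_sub_le_sq_sub_left {u v y : ℝ} (huv : u ≤ v) (hy : 2 * y ≤ u + v) :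
    (y - u) ^ 2 ≤ (y - v) ^ 2 := by
  nlinarith

theorem sq_sub_le_sq_sub_right {u v y : ℝ} (huv : u ≤ v) (hy : v + u ≤ 2 * y) :
    (y - v) ^ 2 ≤ (y - u) ^ 2 := by
  nlinarith

theorem min_sq_sub_eq_left {u v y : ℝ} (huv : u ≤ v) (hy : 2 * y ≤ u + v) :
    min ((y - u) ^ 2) ((y - v) ^ 2) = (y - u) ^ 2 :=
  min_eq_left (sq_sub_le_sq_sub_left huv hy)

theorem min_sq_sub_eq_right {u v y : ℝ} (huv : u ≤ v) (hy : u + v ≤ 2 * y) :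
    min ((y - u) ^ 2) ((y - v) ^ 2) = (y - v) ^ 2 :=
  min_eq_right (sq_sub_le_sq_sub_right huv (by linarith))

theorem le_integral_nuDisc {f : ℝ → ℝ} (hf : Continuous f) {c : ℝ}
    (h : ∀ x ∈ Icc (2 / 5 : ℝ) (3 / 5), c ≤ f x) : c ≤ ∫ x, f x ∂nuDisc := by
  have := integral_le_integral_of_Icc ae_nuDisc_mem (continuous_const (y := c)) hf h
  simpa using this

theorem le_integral_nuDisc_of_sq {f : ℝ → ℝ} (hf : Continuous f) {t : ℝ}
    (h : ∀ x ∈ Icc (2 / 5 : ℝ) (3 / 5), (x - t) ^ 2 ≤ f x) :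
    8 / 1575 + (7 / 15 - t) ^ 2 ≤ ∫ x, f x ∂nuDisc := by
  have h1 := integral_le_integral_of_Icc ae_nuDisc_mem (f := fun x => (1 * x + (-t)) ^ 2)
    (by fun_prop) hf fun x hx => by
      have := h x hx
      rwa [show 1 * x + -t = x - t by ring]
  rw [integral_affine_sq_nuDisc] at h1
  linarith

theorem integral_nuDisc_affine {f : ℝ → ℝ} (hf : Continuous f) (a b : ℝ) :
    ∫ x, f (a * x + b) ∂nuDisc = 1 / 2 * f (a * (2 / 5) + b) +
      1 / 2 * ∫ x, f (a / 2 * x + (a * (3 / 10) + b)) ∂nuDisc := by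
  rw [integral_nuDisc (f := fun x => f (a * x + b)) (by fun_prop)]
  have e : ∀ x : ℝ, a * (x / 2 + 3 / 10) + b = a / 2 * x + (a * (3 / 10) + b) := fun x => by ring
  simp_rw [e]

theorem integral_nuDisc_two {f : ℝ → ℝ} (hf : Continuous f) :
    ∫ x, f x ∂nuDisc = 1 / 2 * f (2 / 5) + 1 / 4 * f (1 / 2) +
      1 / 4 * ∫ x, f (1 / 4 * x + 9 / 20) ∂nuDisc := by
  have h1 := integral_nuDisc_affine hf 1 0
  have h2 := integral_nuDisc_affine hf (1 / 2) (3 / 10)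
  norm_num at h1 h2 ⊢
  linarith

theorem integral_nuDisc_tail_two {f : ℝ → ℝ} (hf : Continuous f) :
    ∫ x, f (1 / 4 * x + 9 / 20) ∂nuDisc = 1 / 2 * f (11 / 20) +
      1 / 2 * ∫ x, f (1 / 8 * x + 21 / 40) ∂nuDisc := by
  have h := integral_nuDisc_affine hf (1 / 4) (9 / 20)
  norm_num at h ⊢
  linarith

theorem integral_nuDisc_tail_three {f : ℝ → ℝ} (hf : Continuous f) :
    ∫ x, f (1 / 8 * x + 21 / 40) ∂nuDisc = 1 / 2 * f (23 / 40) +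
      1 / 2 * ∫ x, f (1 / 16 * x + 9 / 16) ∂nuDisc := by
  have h := integral_nuDisc_affine hf (1 / 8) (21 / 40)
  norm_num at h ⊢
  linarith

theorem integral_nuDisc_tail_four {f : ℝ → ℝ} (hf : Continuous f) :
    ∫ x, f (1 / 16 * x + 9 / 16) ∂nuDisc = 1 / 2 * f (47 / 80) +
      1 / 2 * ∫ x, f (1 / 32 * x + 93 / 160) ∂nuDisc := by
  have h := integral_nuDisc_affine hf (1 / 16) (9 / 16)
  norm_num at h ⊢
  linarith

section TwoPointsDiscrete

variable {f : ℝ → ℝ} {u v : ℝ}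

theorem le_integral_nuDisc_of_split (hf : Continuous f) (huv : u ≤ v)
    (h : ∀ y ∈ Icc (2 / 5 : ℝ) (3 / 5), min ((y - u) ^ 2) ((y - v) ^ 2) ≤ f y)
    (h1 : 2 * (2 / 5) ≤ u + v) (h2 : u + v ≤ 2 * (1 / 2)) :
    1 / 2 * (2 / 5 - u) ^ 2 + 1 / 1575 ≤ ∫ x, f x ∂nuDisc := by
  rw [integral_nuDisc hf]
  have g1 := h (2 / 5) (by norm_num)
  rw [min_sq_sub_eq_left huv h1] at g1
  have g2 := integral_le_integral_of_Icc ae_nuDisc_mem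
    (f := fun x => (1 / 2 * x + (3 / 10 - v)) ^ 2) (g := fun x => f (x / 2 + 3 / 10))
    (by fun_prop) (by fun_prop) fun x hx => by
      have := h (x / 2 + 3 / 10) (by constructor <;> linarith [hx.1, hx.2])
      rw [min_sq_sub_eq_right huv (by linarith [hx.1])] at this
      rwa [show 1 / 2 * x + (3 / 10 - v) = x / 2 + 3 / 10 - v by ring]
  rw [integral_affine_sq_nuDisc] at g2
  nlinarith [sq_nonneg (8 / 15 - v)]

theorem le_integral_nuDisc_of_right (hf : Continuous f) (huv : u ≤ v)
    (h : ∀ y ∈ Icc (2 / 5 : ℝ) (3 / 5), min ((y - u) ^ 2) ((y - v) ^ 2) ≤ f y)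
    (h1 : u + v ≤ 2 * (2 / 5)) : 8 / 1575 + (7 / 15 - v) ^ 2 ≤ ∫ x, f x ∂nuDisc :=
  le_integral_nuDisc_of_sq hf fun x hx => by
    have := h x hx
    rwa [min_sq_sub_eq_right huv (by linarith [hx.1])] at this

theorem le_integral_nuDisc_of_left (hf : Continuous f) (hf0 : ∀ x, 0 ≤ f x) (huv : u ≤ v)
    (h : ∀ y ∈ Icc (2 / 5 : ℝ) (3 / 5), min ((y - u) ^ 2) ((y - v) ^ 2) ≤ f y)
    (h1 : 2 * (1 / 2) ≤ u + v) :
    1 / 2 * (2 / 5 - u) ^ 2 + 1 / 4 * (1 / 2 - u) ^ 2 ≤ ∫ x, f x ∂nuDisc := by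
  rw [integral_nuDisc_two hf]
  have g1 := h (2 / 5) (by norm_num)
  have g2 := h (1 / 2) (by norm_num)
  rw [min_sq_sub_eq_left huv (by linarith)] at g1 g2
  have g3 : 0 ≤ ∫ x, f (1 / 4 * x + 9 / 20) ∂nuDisc := integral_nonneg fun x => hf0 _
  linarith

theorem two_means_lower_nuDisc (hf : Continuous f) (hf0 : ∀ x, 0 ≤ f x) (huv : u ≤ v)
    (h : ∀ y ∈ Icc (2 / 5 : ℝ) (3 / 5), min ((y - u) ^ 2) ((y - v) ^ 2) ≤ f y) :
    1 / 1575 ≤ ∫ x, f x ∂nuDisc := by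
  rcases le_total (2 * (1 / 2)) (u + v) with h1 | h1
  · have := le_integral_nuDisc_of_left hf hf0 huv h h1
    nlinarith [sq_nonneg (u - 13 / 30)]
  · rcases le_total (2 * (2 / 5)) (u + v) with h2 | h2
    · have := le_integral_nuDisc_of_split hf huv h h2 h1
      nlinarith [sq_nonneg (2 / 5 - u)]
    · have := le_integral_nuDisc_of_right hf huv h h2
      nlinarith [sq_nonneg (7 / 15 - v)]

theorem two_means_lower_nuDisc_of_left_lt (hf : Continuous f) (hf0 : ∀ x, 0 ≤ f x) (huv : u ≤ v)
    (h : ∀ y ∈ Icc (2 / 5 : ℝ) (3 / 5), min ((y - u) ^ 2) ((y - v) ^ 2) ≤ f y)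
    (hu : u ≤ 2 / 5) :
    8 / 1575 ≤ ∫ x, f x ∂nuDisc ∨ 1 / 1575 + 1 / 2 * (2 / 5 - u) ^ 2 ≤ ∫ x, f x ∂nuDisc := by
  rcases le_total (2 * (1 / 2)) (u + v) with h1 | h1
  · have := le_integral_nuDisc_of_left hf hf0 huv h h1
    right
    nlinarith
  · rcases le_total (2 * (2 / 5)) (u + v) with h2 | h2
    · have := le_integral_nuDisc_of_split hf huv h h2 h1
      right
      linarith
    · have := le_integral_nuDisc_of_right hf huv h h2
      left
      nlinarith [sq_nonneg (7 / 15 - v)]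

theorem two_means_lower_nuDisc_of_lt_right (hf : Continuous f) (hf0 : ∀ x, 0 ≤ f x)
    (h : ∀ y ∈ Icc (2 / 5 : ℝ) (3 / 5), min ((y - u) ^ 2) ((y - v) ^ 2) ≤ f y)
    (hu : 2 / 5 ≤ u) (hu' : u ≤ 3 / 5) (hv : 3 / 5 ≤ v) :
    51 / 10000 ≤ ∫ x, f x ∂nuDisc ∨
      (v - 3 / 5 ≤ 4 / 25 ∧ 1 / 1575 + 1 / 5 * (v - 3 / 5) ^ 2 ≤ ∫ x, f x ∂nuDisc) ∨
      454 / 100000 ≤ ∫ x, f x ∂nuDisc := by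
  have huv : u ≤ v := hu'.trans hv
  obtain ⟨s, rfl⟩ : ∃ s, v = 3 / 5 + s := ⟨v - 3 / 5, by ring⟩
  have hs : 0 ≤ s := by linarith
  rw [add_sub_cancel_left]
  have tail : ∀ y ∈ Icc (2 / 5 : ℝ) (3 / 5), u + (3 / 5 + s) ≤ 2 * y → s ^ 2 ≤ f y := by
    intro y hy hy'
    have := h y hy
    rw [min_sq_sub_eq_right huv hy'] at this
    nlinarith [hy.2]
  have g1 := h (2 / 5) (by norm_num)
  have g2 := h (1 / 2) (by norm_num)
  have g3 := h (11 / 20) (by norm_num)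
  have g4 := h (23 / 40) (by norm_num)
  have g5 := h (47 / 80) (by norm_num)
  rw [min_sq_sub_eq_left huv (by linarith)] at g1 g2
  rw [integral_nuDisc_two hf]
  rcases le_total (u + (3 / 5 + s)) (2 * (11 / 20)) with h3 | h3
  · have t : s ^ 2 ≤ ∫ x, f (1 / 4 * x + 9 / 20) ∂nuDisc :=
      le_integral_nuDisc (by fun_prop) fun x hx =>
        tail _ (by constructor <;> linarith [hx.1, hx.2]) (by linarith [hx.1])
    rcases le_total s (4 / 25) with h | h
    · right; left
      exact ⟨h, by nlinarith [sq_nonneg (u - 13 / 30)]⟩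
    · left
      nlinarith [sq_nonneg (u - 13 / 30)]
  rw [min_sq_sub_eq_left huv h3] at g3
  rw [integral_nuDisc_tail_two hf]
  rcases le_total (u + (3 / 5 + s)) (2 * (23 / 40)) with h4 | h4
  · have t : s ^ 2 ≤ ∫ x, f (1 / 8 * x + 21 / 40) ∂nuDisc :=
      le_integral_nuDisc (by fun_prop) fun x hx =>
        tail _ (by constructor <;> linarith [hx.1, hx.2]) (by linarith [hx.1])
    rcases le_total s (4 / 25) with h | h
    · right; left
      exact ⟨h, by nlinarith [sq_nonneg (u - 9 / 20)]⟩
    · left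
      nlinarith [sq_nonneg (u - 9 / 20)]
  rw [min_sq_sub_eq_left huv h4] at g4
  rw [integral_nuDisc_tail_three hf]
  rcases le_total (u + (3 / 5 + s)) (2 * (47 / 80)) with h5 | h5
  · have t : s ^ 2 ≤ ∫ x, f (1 / 16 * x + 9 / 16) ∂nuDisc :=
      le_integral_nuDisc (by fun_prop) fun x hx =>
        tail _ (by constructor <;> linarith [hx.1, hx.2]) (by linarith [hx.1])
    rcases le_total s (3 / 20) with h | h
    · right; left
      exact ⟨by linarith, by nlinarith [sq_nonneg (u - (2 / 5 + 7 / 120))]⟩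
    · left
      nlinarith [sq_nonneg (u - (2 / 5 + 7 / 120))]
  rw [min_sq_sub_eq_left huv h5] at g5
  rw [integral_nuDisc_tail_four hf]
  have t : 0 ≤ ∫ x, f (1 / 32 * x + 93 / 160) ∂nuDisc := integral_nonneg fun x => hf0 _
  right; right
  nlinarith [sq_nonneg (u - (2 / 5 + 1 / 16))]

theorem two_means_lower_nuDisc_of_outside (hf : Continuous f) (hf0 : ∀ x, 0 ≤ f x)
    (h : ∀ y ∈ Icc (2 / 5 : ℝ) (3 / 5), min ((y - u) ^ 2) ((y - v) ^ 2) ≤ f y)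
    (hu : u ≤ 2 / 5) (hv : 3 / 5 ≤ v) :
    12 / 1000 ≤ ∫ x, f x ∂nuDisc ∨
      (2 / 5 - u ≤ 4 / 25 ∧ 51 / 10000 + 1 / 4 * (2 / 5 - u) ^ 2 ≤ ∫ x, f x ∂nuDisc) ∨
      (2 / 5 - u ≤ 4 / 25 ∧ v - 3 / 5 ≤ 4 / 25 ∧
        1 / 1575 + 1 / 4 * (2 / 5 - u) ^ 2 + 1 / 5 * (v - 3 / 5) ^ 2 ≤ ∫ x, f x ∂nuDisc) := by
  obtain ⟨s, rfl⟩ : ∃ s, u = 2 / 5 - s := ⟨2 / 5 - u, by ring⟩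
  obtain ⟨t, rfl⟩ : ∃ t, v = 3 / 5 + t := ⟨v - 3 / 5, by ring⟩
  have hs : 0 ≤ s := by linarith
  have ht : 0 ≤ t := by linarith
  rw [add_sub_cancel_left, sub_sub_cancel]
  have g1 := h (2 / 5) (by norm_num)
  have g2 := h (1 / 2) (by norm_num)
  have g3 := h (11 / 20) (by norm_num)
  rw [integral_nuDisc_two hf, integral_nuDisc_tail_two hf]
  have g0 : 0 ≤ ∫ x, f (1 / 8 * x + 21 / 40) ∂nuDisc := integral_nonneg fun x => hf0 _
  have k2 : 1 / 100 ≤ f (1 / 2) := le_trans (le_min (by nlinarith) (by nlinarith)) g2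
  have p3 := hf0 (11 / 20)
  rcases le_total s (4 / 25) with hs' | hs'
  · have k1 : s ^ 2 ≤ f (2 / 5) := le_trans (le_min (by nlinarith) (by nlinarith)) g1
    rcases le_total t (1 / 10) with ht' | ht'
    · right; right
      have k3 : (1 / 20 + t) ^ 2 ≤ f (11 / 20) :=
        le_trans (le_min (by nlinarith) (by nlinarith)) g3
      exact ⟨hs', by linarith, by nlinarith⟩
    · right; left
      have k3 : (3 / 20) ^ 2 ≤ f (11 / 20) :=
        le_trans (le_min (by nlinarith) (by nlinarith)) g3
      exact ⟨hs', by nlinarith⟩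
  · left
    have k1 : (4 / 25) ^ 2 ≤ f (2 / 5) := le_trans (le_min (by nlinarith) (by nlinarith)) g1
    linarith

end TwoPointsDiscrete

namespace IsCondensation

variable {P : Measure ℝ} {f : ℝ → ℝ}

theorem le_integral_of_sq (hP : IsCondensation P nuDisc) (hf : Continuous f) {a b : ℝ}
    (h : ∀ x ∈ Icc (0 : ℝ) 1, (a * x + b) ^ 2 ≤ f x) :
    a ^ 2 * (86696 / 777231) + (a * (19 / 39) + b) ^ 2 ≤ ∫ x, f x ∂P := by
  have := hP.1
  have h1 := integral_le_integral_of_Icc hP.ae_mem (by fun_prop) hf h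
  rw [hP.integral_affine_sq] at h1
  linarith

theorem le_integral_left_of_sq (hP : IsCondensation P nuDisc) (hf : Continuous f) {t : ℝ}
    (h : ∀ y ∈ Icc (0 : ℝ) (1 / 5), (y - t) ^ 2 ≤ f y) :
    86696 / 777231 / 25 + (19 / 195 - t) ^ 2 ≤ ∫ x, f (x / 5) ∂P := by
  have := hP.le_integral_of_sq (f := fun x => f (x / 5)) (a := 1 / 5) (b := -t) (by fun_prop)
    fun x hx => by
      have := h (x / 5) (by constructor <;> linarith [hx.1, hx.2])
      rwa [show 1 / 5 * x + -t = x / 5 - t by ring]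
  linarith

theorem le_integral_right_of_sq (hP : IsCondensation P nuDisc) (hf : Continuous f) {t : ℝ}
    (h : ∀ y ∈ Icc (4 / 5 : ℝ) 1, (y - t) ^ 2 ≤ f y) :
    86696 / 777231 / 25 + (35 / 39 - t) ^ 2 ≤ ∫ x, f (x / 5 + 4 / 5) ∂P := by
  have := hP.le_integral_of_sq (f := fun x => f (x / 5 + 4 / 5)) (a := 1 / 5) (b := 4 / 5 - t)
    (by fun_prop) fun x hx => by
      have := h (x / 5 + 4 / 5) (by constructor <;> linarith [hx.1, hx.2])
      rwa [show 1 / 5 * x + (4 / 5 - t) = x / 5 + 4 / 5 - t by ring]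
  linarith

theorem two_means_lower (hP : IsCondensation P nuDisc) (hf : Continuous f)
    (hf0 : ∀ x, 0 ≤ f x) {u v : ℝ} (huv : u ≤ v)
    (h : ∀ y ∈ Icc (0 : ℝ) 1, min ((y - u) ^ 2) ((y - v) ^ 2) ≤ f y) :
    7 / 500 ≤ ∫ x, f x ∂P := by
  rw [hP.integral_eq hf]
  have hl : 2 * (1 / 5) ≤ u + v →
      86696 / 777231 / 25 + (19 / 195 - u) ^ 2 ≤ ∫ x, f (x / 5) ∂P := fun huv' =>
    hP.le_integral_left_of_sq hf fun y hy => by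
      have := h y (by constructor <;> linarith [hy.1, hy.2])
      rwa [min_sq_sub_eq_left huv (by linarith [hy.2])] at this
  have hr : u + v ≤ 2 * (4 / 5) →
      86696 / 777231 / 25 + (35 / 39 - v) ^ 2 ≤ ∫ x, f (x / 5 + 4 / 5) ∂P := fun huv' =>
    hP.le_integral_right_of_sq hf fun y hy => by
      have := h y (by constructor <;> linarith [hy.1, hy.2])
      rwa [min_sq_sub_eq_right huv (by linarith [hy.1])] at this
  have hnu : ∀ y ∈ Icc (2 / 5 : ℝ) (3 / 5), min ((y - u) ^ 2) ((y - v) ^ 2) ≤ f y := fun y hy =>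
    h y (by constructor <;> linarith [hy.1, hy.2])
  have p1 : 0 ≤ ∫ x, f (x / 5) ∂P := integral_nonneg fun x => hf0 _
  have p2 : 0 ≤ ∫ x, f (x / 5 + 4 / 5) ∂P := integral_nonneg fun x => hf0 _
  rcases le_total (u + v) (2 * (2 / 5)) with h1 | h1
  · have g1 := le_integral_nuDisc_of_right hf huv hnu h1
    have g2 := hr (by linarith)
    nlinarith [sq_nonneg (7 / 15 - v + (35 / 39 - v))]
  rcases le_total (2 * (3 / 5)) (u + v) with h2 | h2
  · have g1 := le_integral_nuDisc_of_sq hf (t := u) fun y hy => by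
      have := hnu y hy
      rwa [min_sq_sub_eq_left huv (by linarith [hy.2])] at this
    have g2 := hl (by linarith)
    nlinarith [sq_nonneg (7 / 15 - u + (19 / 195 - u))]
  have g1 := hl (by linarith)
  have g2 := hr (by linarith)
  have k1 := hnu (2 / 5) (by norm_num)
  have k2 := hnu (1 / 2) (by norm_num)
  rw [min_sq_sub_eq_left huv (by linarith)] at k1
  rw [integral_nuDisc_two hf]
  have g3 : 0 ≤ ∫ x, f (1 / 4 * x + 9 / 20) ∂nuDisc := integral_nonneg fun x => hf0 _
  rcases le_total (u + v) (2 * (1 / 2)) with h3 | h3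
  · rw [min_sq_sub_eq_right huv h3] at k2
    nlinarith [sq_nonneg (u - 0.279), sq_nonneg (v - 0.727)]
  · rw [min_sq_sub_eq_left huv h3] at k2
    nlinarith [sq_nonneg (u - 0.2413), sq_nonneg (v - 35 / 39)]

theorem two_means_lower_left (hP : IsCondensation P nuDisc) (hf : Continuous f)
    (hf0 : ∀ x, 0 ≤ f x) {u v : ℝ} (huv : u ≤ v)
    (h : ∀ y ∈ Icc (0 : ℝ) (1 / 5), min ((y - u) ^ 2) ((y - v) ^ 2) ≤ f y) :
    7 / 12500 ≤ ∫ x, f (x / 5) ∂P := by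
  have h1 := hP.two_means_lower (f := fun x => 25 * f (x / 5)) (u := 5 * u) (v := 5 * v)
    (by fun_prop) (fun x => by linarith [hf0 (x / 5)]) (by linarith) fun x hx => by
      have := h (x / 5) (by constructor <;> linarith [hx.1, hx.2])
      rcases min_le_iff.1 this with h | h
      · exact min_le_of_left_le (by linarith)
      · exact min_le_of_right_le (by linarith)
  rw [integral_const_mul] at h1
  linarith

theorem two_means_lower_right (hP : IsCondensation P nuDisc) (hf : Continuous f)
    (hf0 : ∀ x, 0 ≤ f x) {u v : ℝ} (huv : u ≤ v)
    (h : ∀ y ∈ Icc (4 / 5 : ℝ) 1, min ((y - u) ^ 2) ((y - v) ^ 2) ≤ f y) :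
    7 / 12500 ≤ ∫ x, f (x / 5 + 4 / 5) ∂P := by
  have h1 := hP.two_means_lower (f := fun x => 25 * f (x / 5 + 4 / 5)) (u := 5 * u - 4)
    (v := 5 * v - 4) (by fun_prop) (fun x => by linarith [hf0 (x / 5 + 4 / 5)]) (by linarith)
    fun x hx => by
      have := h (x / 5 + 4 / 5) (by constructor <;> linarith [hx.1, hx.2])
      rcases min_le_iff.1 this with h | h
      · exact min_le_of_left_le (by linarith)
      · exact min_le_of_right_le (by linarith)
  rw [integral_const_mul] at h1
  linarith

theorem le_integral_of_sq_sub (hP : IsCondensation P nuDisc) (hf : Continuous f) {a b c : ℝ}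
    (h : ∀ x ∈ Icc (0 : ℝ) 1, (a * x + b) ^ 2 - c ≤ f x) :
    a ^ 2 * (86696 / 777231) + (a * (19 / 39) + b) ^ 2 - c ≤ ∫ x, f x ∂P := by
  have := hP.1
  have h1 := hP.le_integral_of_sq (f := fun x => f x + c) (a := a) (b := b) (by fun_prop)
    fun x hx => by linarith [h x hx]
  rw [integral_add (hf.integrable_of_ae_mem_Icc hP.ae_mem) (integrable_const _)] at h1
  simp only [integral_const, probReal_univ, one_smul] at h1
  linarith

theorem two_means_lower_left_of_near (hP : IsCondensation P nuDisc) (hf : Continuous f)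
    {u v : ℝ} (hu : 0 ≤ u) (huv : u ≤ v)
    (h : ∀ y ∈ Icc (0 : ℝ) (1 / 5), min ((y - u) ^ 2) ((y - v) ^ 2) ≤ f y)
    (hv : 2 / 5 - v ≤ 4 / 25) :
    86696 / 777231 / 25 - 1 / 4 * (2 / 5 - v) ^ 2 ≤ ∫ x, f (x / 5) ∂P := by
  have near : ∀ y ∈ Icc (0 : ℝ) (3 / 25), (y - u) ^ 2 ≤ f y := fun y hy => by
    have := h y (by constructor <;> linarith [hy.1, hy.2])
    rwa [min_sq_sub_eq_left huv (by linarith [hy.2])] at this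
  rw [hP.integral_eq (f := fun x => f (x / 5)) (by fun_prop)]
  have g1 := hP.le_integral_of_sq (f := fun x => f (x / 5 / 5)) (a := 1 / 25) (b := -u)
    (by fun_prop) fun x hx => by
      rw [show 1 / 25 * x + -u = x / 5 / 5 - u by ring]
      exact near _ (by constructor <;> linarith [hx.1, hx.2])
  have g3 := integral_le_integral_of_Icc ae_nuDisc_mem (f := fun x => (1 / 5 * x + -u) ^ 2)
    (g := fun x => f (x / 5)) (by fun_prop) (by fun_prop) fun x hx => by
      rw [show 1 / 5 * x + -u = x / 5 - u by ring]
      exact near _ (by constructor <;> linarith [hx.1, hx.2])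
  rw [integral_affine_sq_nuDisc] at g3
  have g2 := hP.le_integral_of_sq_sub (f := fun x => f ((x / 5 + 4 / 5) / 5)) (a := 1 / 25)
    (b := 4 / 25 - u) (c := max 0 ((v - u) * (2 / 5 - u - v))) (by fun_prop) fun x hx => by
      rw [show 1 / 25 * x + (4 / 25 - u) = (x / 5 + 4 / 5) / 5 - u by ring]
      set y := (x / 5 + 4 / 5) / 5 with hy
      have hy1 : y ≤ 1 / 5 := by linarith [hx.2]
      refine le_trans (le_min ?_ ?_) (h y ⟨by linarith [hx.1], hy1⟩)
      · linarith [le_max_left 0 ((v - u) * (2 / 5 - u - v))]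
      · nlinarith [le_max_right 0 ((v - u) * (2 / 5 - u - v))]
  rcases le_total ((v - u) * (2 / 5 - u - v)) 0 with h0 | h0
  · rw [max_eq_left h0] at g2
    nlinarith [sq_nonneg (u - 19 / 195), sq_nonneg (2 / 5 - v)]
  · rw [max_eq_right h0] at g2
    nlinarith [sq_nonneg (u - 0.04615), sq_nonneg (2 / 5 - v - 0.1145)]

theorem two_means_lower_right_of_near (hP : IsCondensation P nuDisc) (hf : Continuous f)
    {u v : ℝ} (hv : v ≤ 1) (huv : u ≤ v)
    (h : ∀ y ∈ Icc (4 / 5 : ℝ) 1, min ((y - u) ^ 2) ((y - v) ^ 2) ≤ f y)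
    (hu : u - 3 / 5 ≤ 4 / 25) :
    86696 / 777231 / 25 - 1 / 5 * (u - 3 / 5) ^ 2 ≤ ∫ x, f (x / 5 + 4 / 5) ∂P := by
  have near : ∀ y ∈ Icc (22 / 25 : ℝ) 1, (y - v) ^ 2 ≤ f y := fun y hy => by
    have := h y (by constructor <;> linarith [hy.1, hy.2])
    rwa [min_sq_sub_eq_right huv (by linarith [hy.1])] at this
  rw [hP.integral_eq (f := fun x => f (x / 5 + 4 / 5)) (by fun_prop)]
  have g1 := hP.le_integral_of_sq (f := fun x => f ((x / 5 + 4 / 5) / 5 + 4 / 5)) (a := 1 / 25)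
    (b := 24 / 25 - v) (by fun_prop) fun x hx => by
      rw [show 1 / 25 * x + (24 / 25 - v) = (x / 5 + 4 / 5) / 5 + 4 / 5 - v by ring]
      exact near _ (by constructor <;> linarith [hx.1, hx.2])
  have g3 := integral_le_integral_of_Icc ae_nuDisc_mem
    (f := fun x => (1 / 5 * x + (4 / 5 - v)) ^ 2)
    (g := fun x => f (x / 5 + 4 / 5)) (by fun_prop) (by fun_prop) fun x hx => by
      rw [show 1 / 5 * x + (4 / 5 - v) = x / 5 + 4 / 5 - v by ring]
      exact near _ (by constructor <;> linarith [hx.1, hx.2])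
  rw [integral_affine_sq_nuDisc] at g3
  have g2 := hP.le_integral_of_sq_sub (f := fun x => f (x / 5 / 5 + 4 / 5)) (a := 1 / 25)
    (b := 4 / 5 - v) (c := max 0 ((v - u) * (u + v - 8 / 5))) (by fun_prop) fun x hx => by
      rw [show 1 / 25 * x + (4 / 5 - v) = x / 5 / 5 + 4 / 5 - v by ring]
      set y := x / 5 / 5 + 4 / 5 with hy
      have hy1 : 4 / 5 ≤ y := by linarith [hx.1]
      refine le_trans (le_min ?_ ?_) (h y ⟨hy1, by linarith [hx.2]⟩)
      · nlinarith [le_max_right 0 ((v - u) * (u + v - 8 / 5))]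
      · linarith [le_max_left 0 ((v - u) * (u + v - 8 / 5))]
  rcases le_total ((v - u) * (u + v - 8 / 5)) 0 with h0 | h0
  · rw [max_eq_left h0] at g2
    nlinarith [sq_nonneg (v - 35 / 39), sq_nonneg (u - 3 / 5)]
  · rw [max_eq_right h0] at g2
    nlinarith [sq_nonneg (1 - v - 0.0538), sq_nonneg (u - 3 / 5 - 0.125)]

theorem four_means_lower_of_sorted (hP : IsCondensation P nuDisc) (hf : Continuous f)
    (hf0 : ∀ x, 0 ≤ f x) {p q q' r : ℝ} (hp : 0 ≤ p) (hpq : p ≤ q) (hqq : q ≤ q')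
    (hqr : q' ≤ r) (hr : r ≤ 1)
    (h : ∀ y ∈ Icc (0 : ℝ) 1, min (min ((y - p) ^ 2) ((y - q) ^ 2))
      (min ((y - q') ^ 2) ((y - r) ^ 2)) ≤ f y) :
    185729 / 58292325 ≤ ∫ x, f x ∂P := by
  rw [hP.integral_eq hf]
  have n1 : 0 ≤ ∫ x, f (x / 5) ∂P := integral_nonneg fun x => hf0 _
  have n2 : 0 ≤ ∫ x, f (x / 5 + 4 / 5) ∂P := integral_nonneg fun x => hf0 _
  have n3 : 0 ≤ ∫ x, f x ∂nuDisc := integral_nonneg hf0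
  rcases lt_or_ge (1 / 5) p with hp5 | hp5
  · have := hP.le_integral_left_of_sq hf (t := 1 / 5) fun y hy =>
      le_trans (le_min (le_min
          (sq_sub_le_sq_sub_left (by linarith) (by linarith [hy.1, hy.2]))
          (sq_sub_le_sq_sub_left (by linarith) (by linarith [hy.1, hy.2])))
        (le_min
          (sq_sub_le_sq_sub_left (by linarith) (by linarith [hy.1, hy.2]))
          (sq_sub_le_sq_sub_left (by linarith) (by linarith [hy.1, hy.2]))))
        (h y (by constructor <;> linarith [hy.1, hy.2]))
    linarith
  rcases lt_or_ge r (4 / 5) with hr5 | hr5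
  · have := hP.le_integral_right_of_sq hf (t := 4 / 5) fun y hy =>
      le_trans (le_min (le_min
          (sq_sub_le_sq_sub_right (by linarith) (by linarith [hy.1, hy.2]))
          (sq_sub_le_sq_sub_right (by linarith) (by linarith [hy.1, hy.2])))
        (le_min
          (sq_sub_le_sq_sub_right (by linarith) (by linarith [hy.1, hy.2]))
          (sq_sub_le_sq_sub_right (by linarith) (by linarith [hy.1, hy.2]))))
        (h y (by constructor <;> linarith [hy.1, hy.2]))
    linarith
  have right_one : q' ≤ 3 / 5 → 86696 / 777231 / 25 ≤ ∫ x, f (x / 5 + 4 / 5) ∂P := fun hq => by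
    have := hP.le_integral_right_of_sq hf (t := r) fun y hy =>
      le_trans (le_min (le_min
          (sq_sub_le_sq_sub_right (by linarith) (by linarith [hy.1, hy.2]))
          (sq_sub_le_sq_sub_right (by linarith) (by linarith [hy.1, hy.2])))
        (le_min
          (sq_sub_le_sq_sub_right (by linarith) (by linarith [hy.1, hy.2])) le_rfl))
        (h y (by constructor <;> linarith [hy.1, hy.2]))
    nlinarith [sq_nonneg (35 / 39 - r)]
  have left_one : 2 / 5 ≤ q → 86696 / 777231 / 25 ≤ ∫ x, f (x / 5) ∂P := fun hq => by
    have := hP.le_integral_left_of_sq hf (t := p) fun y hy =>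
      le_trans (le_min (le_min le_rfl
          (sq_sub_le_sq_sub_left (by linarith) (by linarith [hy.1, hy.2])))
        (le_min
          (sq_sub_le_sq_sub_left (by linarith) (by linarith [hy.1, hy.2]))
          (sq_sub_le_sq_sub_left (by linarith) (by linarith [hy.1, hy.2]))))
        (h y (by constructor <;> linarith [hy.1, hy.2]))
    nlinarith [sq_nonneg (19 / 195 - p)]
  rcases lt_or_ge q' (2 / 5) with hq'5 | hq'5
  · have := le_integral_nuDisc_of_sq hf (t := 2 / 5) fun y hy =>
      le_trans (le_min (le_min
          (sq_sub_le_sq_sub_right (by linarith) (by linarith [hy.1, hy.2]))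
          (sq_sub_le_sq_sub_right (by linarith) (by linarith [hy.1, hy.2])))
        (le_min
          (sq_sub_le_sq_sub_right (by linarith) (by linarith [hy.1, hy.2]))
          (sq_sub_le_sq_sub_left (by linarith) (by linarith [hy.1, hy.2]))))
        (h y (by constructor <;> linarith [hy.1, hy.2]))
    have := right_one (by linarith)
    linarith
  rcases lt_or_ge (3 / 5) q with hq5 | hq5
  · have := le_integral_nuDisc_of_sq hf (t := 3 / 5) fun y hy =>
      le_trans (le_min (le_min
          (sq_sub_le_sq_sub_right (by linarith) (by linarith [hy.1, hy.2]))
          (sq_sub_le_sq_sub_left (by linarith) (by linarith [hy.1, hy.2])))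
        (le_min
          (sq_sub_le_sq_sub_left (by linarith) (by linarith [hy.1, hy.2]))
          (sq_sub_le_sq_sub_left (by linarith) (by linarith [hy.1, hy.2]))))
        (h y (by constructor <;> linarith [hy.1, hy.2]))
    linarith
  have hleft : ∀ y ∈ Icc (0 : ℝ) (1 / 5), min ((y - p) ^ 2) ((y - q) ^ 2) ≤ f y := by
    intro y hy
    have k : (y - p) ^ 2 ≤ (y - q') ^ 2 := sq_sub_le_sq_sub_left (by linarith) (by linarith [hy.1, hy.2])
    have k' : (y - p) ^ 2 ≤ (y - r) ^ 2 := sq_sub_le_sq_sub_left (by linarith) (by linarith [hy.1, hy.2])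
    exact le_trans (le_min le_rfl (le_min (min_le_of_left_le k) (min_le_of_left_le k')))
      (h y (by constructor <;> linarith [hy.1, hy.2]))
  have hright : ∀ y ∈ Icc (4 / 5 : ℝ) 1, min ((y - q') ^ 2) ((y - r) ^ 2) ≤ f y := by
    intro y hy
    have k : (y - r) ^ 2 ≤ (y - q) ^ 2 := sq_sub_le_sq_sub_right (by linarith) (by linarith [hy.1, hy.2])
    have k' : (y - r) ^ 2 ≤ (y - p) ^ 2 := sq_sub_le_sq_sub_right (by linarith) (by linarith [hy.1, hy.2])
    exact le_trans (le_min (le_min (min_le_of_right_le k') (min_le_of_right_le k)) le_rfl)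
      (h y (by constructor <;> linarith [hy.1, hy.2]))
  have hmid : ∀ y ∈ Icc (2 / 5 : ℝ) (3 / 5), min ((y - q) ^ 2) ((y - q') ^ 2) ≤ f y := by
    intro y hy
    have k : (y - q) ^ 2 ≤ (y - p) ^ 2 := sq_sub_le_sq_sub_right (by linarith) (by linarith [hy.1, hy.2])
    have k' : (y - q') ^ 2 ≤ (y - r) ^ 2 := sq_sub_le_sq_sub_left (by linarith) (by linarith [hy.1, hy.2])
    exact le_trans (le_min (le_min (min_le_of_left_le k) (min_le_left _ _))
      (le_min (min_le_right _ _) (min_le_of_right_le k')))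
      (h y (by constructor <;> linarith [hy.1, hy.2]))
  have left_two := hP.two_means_lower_left hf hf0 hpq hleft
  have left_near := hP.two_means_lower_left_of_near hf hp hpq hleft
  have right_two := hP.two_means_lower_right hf hf0 hqr hright
  have right_near := hP.two_means_lower_right_of_near hf hr hqr hright
  rcases le_total (2 / 5) q with hq | hq <;> rcases le_total q' (3 / 5) with hq' | hq'
  · have := two_means_lower_nuDisc hf hf0 hqq hmid
    linarith [left_one hq, right_one hq']
  · have := left_one hq
    rcases two_means_lower_nuDisc_of_lt_right hf hf0 hmid hq hq5 hq' with g | ⟨g0, g⟩ | g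
    · linarith
    · linarith [right_near g0]
    · linarith
  · have := right_one hq'
    rcases two_means_lower_nuDisc_of_left_lt hf hf0 hqq hmid hq with g | g
    · linarith
    · rcases le_total (2 / 5 - q) (4 / 25) with g0 | g0
      · nlinarith [left_near g0, sq_nonneg (2 / 5 - q)]
      · nlinarith
  · rcases two_means_lower_nuDisc_of_outside hf hf0 hmid hq hq' with g | ⟨g0, g⟩ | ⟨g0, g1, g⟩
    · linarith
    · linarith [left_near g0]
    · linarith [left_near g0, right_near g1]

end IsCondensation

theorem infDist_sq_le_sq_sub {α : Set ℝ} {a : ℝ} (ha : a ∈ α) (x : ℝ) :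
    Metric.infDist x α ^ 2 ≤ (x - a) ^ 2 := by
  have h := Metric.infDist_le_dist_of_mem (x := x) ha
  rw [Real.dist_eq] at h
  rw [← sq_abs (x - a)]
  exact pow_le_pow_left₀ Metric.infDist_nonneg h 2

theorem IsCondensation.four_means_lower {P : Measure ℝ} (hP : IsCondensation P nuDisc)
    {α : Set ℝ} (hfin : α.Finite) (hne : α.Nonempty) (hcard : α.ncard ≤ 4) :
    185729 / 58292325 ≤ distortion P α := by
  obtain ⟨t, hαt, ht⟩ := Infinite.exists_superset_card_eq hfin.toFinset 4
    (by rwa [← Set.ncard_eq_toFinset_card α hfin])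
  set e := t.orderEmbOfFin ht with he
  set c : ℝ → ℝ := fun y => max 0 (min 1 y) with hc
  have hcm : ∀ {i j : Fin 4}, i ≤ j → c (e i) ≤ c (e j) := fun hij =>
    max_le_max le_rfl (min_le_min le_rfl (e.monotone hij))
  refine hP.four_means_lower_of_sorted (f := fun x => Metric.infDist x α ^ 2)
    ((Metric.continuous_infDist_pt α).pow 2) (fun x => sq_nonneg _)
    (p := c (e 0)) (q := c (e 1)) (q' := c (e 2)) (r := c (e 3))
    (le_max_left _ _) (hcm (by decide)) (hcm (by decide)) (hcm (by decide))
    (max_le zero_le_one (min_le_left _ _)) fun y hy => ?_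
  obtain ⟨a, ha, hya⟩ := hfin.isCompact.exists_infDist_eq_dist hne y
  rw [hya, Real.dist_eq, sq_abs]
  have hclip : (y - c a) ^ 2 ≤ (y - a) ^ 2 := by
    simp only [hc]
    rcases le_total a 0 with h0 | h0
    · rw [max_eq_left (min_le_of_right_le h0)]
      nlinarith [hy.1]
    · rcases le_total a 1 with h1 | h1
      · rw [min_eq_right h1, max_eq_right h0]
      · rw [min_eq_left h1, max_eq_right zero_le_one]
        nlinarith [hy.2]
  refine le_trans ?_ hclip
  have hat : a ∈ Set.range e := by
    rw [he, Finset.range_orderEmbOfFin]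
    exact hαt (hfin.mem_toFinset.2 ha)
  obtain ⟨i, rfl⟩ := hat
  fin_cases i
  · exact min_le_of_left_le (min_le_left _ _)
  · exact min_le_of_left_le (min_le_right _ _)
  · exact min_le_of_right_le (min_le_left _ _)
  · exact min_le_of_right_le (min_le_right _ _)

theorem ncard_pair_le (a b : ℝ) : ({a, b} : Set ℝ).ncard ≤ 2 := by
  simpa using Set.ncard_insert_le a {b}

theorem quantErr_le {μ : Measure ℝ} {n : ℕ} {α : Set ℝ} (hfin : α.Finite) (hne : α.Nonempty)
    (hcard : α.ncard ≤ n) : quantErr μ n ≤ distortion μ α :=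
  csInf_le ⟨0, by
    rintro _ ⟨γ, -, -, -, rfl⟩
    exact integral_nonneg fun x => sq_nonneg _⟩ ⟨α, hfin, hne, hcard, rfl⟩

theorem distortion_nuDisc_pair_le : distortion nuDisc {2 / 5, 8 / 15} ≤ 1 / 1575 := by
  set α : Set ℝ := {2 / 5, 8 / 15} with hα
  have hc : Continuous fun x => Metric.infDist x α ^ 2 := (Metric.continuous_infDist_pt α).pow 2
  rw [distortion, integral_nuDisc hc]
  have h1 := infDist_sq_le_sq_sub (α := α) (a := 2 / 5) (by simp [hα]) (2 / 5)
  have h2 := integral_le_integral_of_Icc ae_nuDisc_mem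
    (f := fun x => Metric.infDist (x / 2 + 3 / 10) α ^ 2)
    (g := fun x => (1 / 2 * x + (3 / 10 - 8 / 15)) ^ 2)
    (hc.comp (by fun_prop : Continuous fun x : ℝ => x / 2 + 3 / 10)) (by fun_prop) fun x _ => by
      have := infDist_sq_le_sq_sub (α := α) (a := 8 / 15) (by simp [hα]) (x / 2 + 3 / 10)
      linarith
  rw [integral_affine_sq_nuDisc] at h2
  linarith

theorem IsCondensation.distortion_union_le {P : Measure ℝ} (hP : IsCondensation P nuDisc)
    {β : Set ℝ} (hne : β.Nonempty) (hβ : distortion nuDisc β ≤ 1 / 1575) :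
    distortion P (({19 / 195, 35 / 39} : Set ℝ) ∪ β) ≤ 185729 / 58292325 := by
  have := hP.1
  set α : Set ℝ := ({19 / 195, 35 / 39} : Set ℝ) ∪ β with hα
  have hc : Continuous fun x => Metric.infDist x α ^ 2 := (Metric.continuous_infDist_pt α).pow 2
  rw [distortion, hP.integral_eq hc]
  have h1 := integral_le_integral_of_Icc hP.ae_mem
    (f := fun x => Metric.infDist (x / 5) α ^ 2) (g := fun x => (1 / 5 * x + -(19 / 195)) ^ 2)
    (hc.comp (by fun_prop : Continuous fun x : ℝ => x / 5)) (by fun_prop) fun x _ => by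
      have := infDist_sq_le_sq_sub (α := α) (a := 19 / 195) (by simp [hα]) (x / 5)
      linarith
  have h2 := integral_le_integral_of_Icc hP.ae_mem
    (f := fun x => Metric.infDist (x / 5 + 4 / 5) α ^ 2)
    (g := fun x => (1 / 5 * x + (4 / 5 - 35 / 39)) ^ 2)
    (hc.comp (by fun_prop : Continuous fun x : ℝ => x / 5 + 4 / 5)) (by fun_prop) fun x _ => by
      have := infDist_sq_le_sq_sub (α := α) (a := 35 / 39) (by simp [hα]) (x / 5 + 4 / 5)
      linarith
  rw [hP.integral_affine_sq] at h1 h2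
  have h3 : ∫ x, Metric.infDist x α ^ 2 ∂nuDisc ≤ distortion nuDisc β :=
    integral_le_integral_of_Icc ae_nuDisc_mem hc ((Metric.continuous_infDist_pt β).pow 2)
      fun x _ => pow_le_pow_left₀ Metric.infDist_nonneg
        (Metric.infDist_le_infDist_of_subset Set.subset_union_right hne) 2
  linarith

theorem IsCondensation.quantErr_four {P : Measure ℝ} (hP : IsCondensation P nuDisc) :
    quantErr P 4 = 185729 / 58292325 := by
  have hcard : (({19 / 195, 35 / 39} : Set ℝ) ∪ {2 / 5, 8 / 15}).ncard ≤ 4 :=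
    (Set.ncard_union_le _ _).trans (add_le_add (ncard_pair_le _ _) (ncard_pair_le _ _))
  apply le_antisymm
  · exact (quantErr_le ((Set.toFinite _).union (Set.toFinite _)) (by simp) hcard).trans
      (hP.distortion_union_le (by simp) distortion_nuDisc_pair_le)
  · refine le_csInf ⟨_, {0}, by simp, by simp, by simp, rfl⟩ ?_
    rintro _ ⟨α, hfin, hne, hα, rfl⟩
    exact hP.four_means_lower hfin hne hα

theorem optimal_four_means_discrete (P : MeasureTheory.Measure ℝ)
    (hP : IsCondensation P nuDisc) :
    (∀ β : Set ℝ, IsOptimalSet nuDisc 2 β →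
      IsOptimalSet P 4 (({19 / 195, 35 / 39} : Set ℝ) ∪ β)) ∧
      quantErr P 4 = 185729 / 58292325 := by
  refine ⟨fun β hβ => ?_, hP.quantErr_four⟩
  obtain ⟨hfin, hne, hcard, hopt⟩ := hβ
  have hν : distortion nuDisc β ≤ 1 / 1575 := hopt.le.trans
    ((quantErr_le (Set.toFinite _) (by simp) (ncard_pair_le _ _)).trans distortion_nuDisc_pair_le)
  have hfin' : (({19 / 195, 35 / 39} : Set ℝ) ∪ β).Finite := (Set.toFinite _).union hfin
  have hne' : (({19 / 195, 35 / 39} : Set ℝ) ∪ β).Nonempty := hne.inr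
  have hcard' : (({19 / 195, 35 / 39} : Set ℝ) ∪ β).ncard ≤ 4 :=
    (Set.ncard_union_le _ _).trans (add_le_add (ncard_pair_le _ _) hcard)
  refine ⟨hfin', hne', hcard', ?_⟩
  rw [hP.quantErr_four]
  exact (hP.distortion_union_le hne hν).antisymm (hP.four_means_lower hfin' hne' hcard')
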